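/- arXiv:2402.01820 — 2 statements merged into one kernel-verified Lean document; each statement's English description precedes it below -/
import Mathlib

section
/- Let ℓ ∈ T((ℝ^d)) be supported on single-letter words, i.e. ℓ = Σ_{i=1}^d ℓ^i e_i with ℓ^i ∈ ℝ and e_i the i-th letter. Then for every n ≥ 0, ℓ^⧢(n+1) = (n+1) · (ℓ^⧢n ⊗ ℓ), where ⧢ is the shuffle product and ⊗ the concatenation product. -/
/-- Words over the alphabet `{1, …, d}`, modeled as lists over `Fin d`. -/
abbrev Word (d : ℕ) := List (Fin d)

/-- The extended tensor algebra `T((ℝ^d))`, modeled as real-valued functions on words. -/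
abbrev Tensor (d : ℕ) := Word d → ℝ

namespace Sig

/-- The unit `𝟙`: the indicator of the empty word. -/
def unit (d : ℕ) : Tensor d := fun w => if w = [] then 1 else 0

/-- The concatenation product `(ℓ ⊗ p)(w) = Σ_{w = u·v} ℓ(u) p(v)`. -/
def concatProd {d : ℕ} (l p : Tensor d) : Tensor d :=
  fun w => ∑ i ∈ Finset.range (w.length + 1), l (w.take i) * p (w.drop i)

/-- `n`-fold concatenation power, `ℓ^⊗0 = 𝟙`. -/
def concatPow {d : ℕ} (l : Tensor d) : ℕ → Tensor d
  | 0 => unit d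
  | n + 1 => concatProd (concatPow l n) l

/-- The letter `e_i`: the indicator of the one-letter word `i`. -/
def letter {d : ℕ} (i : Fin d) : Tensor d := fun w => if w = [i] then 1 else 0

/-- The shuffle product on `T((ℝ^d))`, the coefficientwise bilinear extension of the
inductive shuffle of words. -/
def shuffle {d : ℕ} : Tensor d → Tensor d → Word d → ℝ
  | l, m, [] => l [] * m []
  | l, m, i :: w => shuffle (fun u => l (i :: u)) m w + shuffle l (fun u => m (i :: u)) w

/-- `n`-fold shuffle power, `ℓ^⧢0 = 𝟙`. -/
def shufflePow {d : ℕ} (l : Tensor d) : ℕ → Tensor d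
  | 0 => unit d
  | n + 1 => shuffle (shufflePow l n) l

/-- The resolvent `(𝟙 − q)^{-1} = Σ_{n≥0} q^⊗n`, defined coefficientwise. -/
noncomputable def resolvent {d : ℕ} (q : Tensor d) : Tensor d :=
  fun w => ∑' n : ℕ, concatPow q n w

/-- The shuffle exponential `exp_⧢(ℓ) = Σ_{n≥0} ℓ^⧢n / n!`, defined coefficientwise. -/
noncomputable def shuffleExp {d : ℕ} (l : Tensor d) : Tensor d :=
  fun w => ∑' n : ℕ, shufflePow l n w / (n.factorial : ℝ)

/-- Right-deconcatenation (projection) by a word `u`: `(ℓ π_u)(w) = ℓ(w·u)`. -/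
def proj {d : ℕ} (l : Tensor d) (u : Word d) : Tensor d := fun w => l (w ++ u)

/-- The function `w ↦ ∏ c w_k` on words of length `n`, and zero elsewhere. -/
def homog {d : ℕ} (c : Fin d → ℝ) : ℕ → Word d → ℝ
  | 0, [] => 1
  | 0, _ :: _ => 0
  | _ + 1, [] => 0
  | n + 1, i :: w => c i * homog c n w

theorem homog_zero {d : ℕ} (c : Fin d → ℝ) : homog c 0 = unit d := by
  funext w
  cases w <;> simp [homog, unit]

theorem homog_one {d : ℕ} (c : Fin d → ℝ) :
    homog c 1 = ∑ i : Fin d, c i • letter i := by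
  funext w
  rcases w with _ | ⟨i, _ | ⟨j, w⟩⟩ <;> simp [homog, letter, Finset.sum_apply]

theorem shuffle_zero_left {d : ℕ} (m : Tensor d) (w : Word d) :
    shuffle (fun _ => 0) m w = 0 := by
  induction w generalizing m with
  | nil => simp [shuffle]
  | cons i w ih => simp [shuffle, ih]

theorem shuffle_zero_right {d : ℕ} (m : Tensor d) (w : Word d) :
    shuffle m (fun _ => 0) w = 0 := by
  induction w generalizing m with
  | nil => simp [shuffle]
  | cons i w ih => simp [shuffle, ih]

theorem shuffle_unit {d : ℕ} (c : Fin d → ℝ) (m : Tensor d) (b : ℝ) (w : Word d) :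
    shuffle m (fun u => b * homog c 0 u) w = b * m w := by
  induction w generalizing m with
  | nil => simp [shuffle, homog, mul_comm]
  | cons i w ih => simp [shuffle, ih, homog, shuffle_zero_right]

theorem shuffle_homog {d : ℕ} (c : Fin d → ℝ) (n : ℕ) (a : ℝ) (w : Word d) :
    shuffle (fun u => a * homog c n u) (homog c 1) w
      = ((n : ℝ) + 1) * (a * homog c (n + 1) w) := by
  induction w generalizing n a with
  | nil => simp [shuffle, homog]
  | cons i w ih =>
    have h : (fun u => homog c 1 (i :: u)) = fun u => c i * homog c 0 u := by
      funext u; simp [homog]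
    rw [shuffle, h, shuffle_unit]
    cases n with
    | zero => simp [homog, shuffle_zero_left]; ring
    | succ n =>
      have h2 : (fun u => a * homog c (n + 1) (i :: u))
          = fun u => (a * c i) * homog c n u := by
        funext u; simp [homog, mul_assoc]
      rw [h2, ih]
      simp only [homog]
      push_cast
      ring

theorem concatProd_cons {d : ℕ} (f m : Tensor d) (i : Fin d) (w : Word d) :
    concatProd f m (i :: w)
      = f [] * m (i :: w) + concatProd (fun u => f (i :: u)) m w := by
  simp only [concatProd, List.length_cons]
  rw [Finset.sum_range_succ']
  simp [add_comm]

theorem concatProd_homog {d : ℕ} (c : Fin d → ℝ) (n : ℕ) (a : ℝ) (w : Word d) :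
    concatProd (fun u => a * homog c n u) (homog c 1) w = a * homog c (n + 1) w := by
  induction w generalizing n a with
  | nil => simp [concatProd, homog]
  | cons i w ih =>
    rw [concatProd_cons]
    cases n with
    | zero => simp [homog, concatProd]
    | succ n =>
      have h2 : (fun u => a * homog c (n + 1) (i :: u))
          = fun u => (a * c i) * homog c n u := by
        funext u; simp [homog, mul_assoc]
      rw [h2, ih]
      simp only [homog]
      ring

theorem shufflePow_homog {d : ℕ} (c : Fin d → ℝ) (n : ℕ) :
    ∃ a : ℝ, shufflePow (homog c 1) n = fun u => a * homog c n u := by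
  induction n with
  | zero => exact ⟨1, by simp [shufflePow, homog_zero]⟩
  | succ n ih =>
    obtain ⟨a, ha⟩ := ih
    refine ⟨((n : ℝ) + 1) * a, ?_⟩
    funext w
    rw [shufflePow, ha, shuffle_homog, mul_assoc]

/-- for `ℓ` supported on single-letter words,
`ℓ^⧢(n+1) = (n+1) · (ℓ^⧢n ⊗ ℓ)`. -/
theorem shufflePow_succ_eq_concat {d : ℕ} (hd : 1 ≤ d) (l : Tensor d) (c : Fin d → ℝ)
    (hl : l = ∑ i : Fin d, c i • letter i) (n : ℕ) :
    shufflePow l (n + 1) = ((n : ℝ) + 1) • concatProd (shufflePow l n) l := by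
  rw [← homog_one] at hl
  subst hl
  obtain ⟨a, ha⟩ := shufflePow_homog c n
  funext w
  rw [shufflePow, ha, shuffle_homog, Pi.smul_apply, concatProd_homog, smul_eq_mul]

end Sig
end

section
/- Let y, κ, θ, η, α ∈ ℝ and set σ^mGBM := (y·𝟙 + (κθ − αη/2)·e_1 + η·e_2) ⊗ exp_⧢(−(κ + α²/2)·e_1 + α·e_2) ∈ T((ℝ²)). Then: (i) the empty-word coefficient of σ^mGBM equals y; (ii) σ^mGBM π_1 = (κθ − αη/2)·𝟙 − (κ + α²/2)·σ^mGBM; (iii) σ^mGBM π_2 = η·𝟙 + α·σ^mGBM; (iv) σ^mGBM π_{22} = αη·𝟙 + α²·σ^mGBM. -/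
namespace Sig

/-- The tensor-algebra representation of the mean-reverting geometric Brownian motion:
`σ^mGBM = (y·𝟙 + (κθ − αη/2)·e_1 + η·e_2) ⊗ exp_⧢(−(κ + α²/2)·e_1 + α·e_2)`. -/
noncomputable def sigmaMGBM (y kappa theta eta alpha : ℝ) : Tensor 2 :=
  concatProd
    (y • unit 2 + (kappa * theta - alpha * eta / 2) • letter (0 : Fin 2) +
      eta • letter (1 : Fin 2))
    (shuffleExp ((-(kappa + alpha ^ 2 / 2)) • letter (0 : Fin 2) + alpha • letter (1 : Fin 2)))

theorem shuffle_zero {d : ℕ} (w : Word d) : ∀ m : Tensor d, shuffle m (fun _ => 0) w = 0 := by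
  induction w with
  | nil => intro m; simp [shuffle]
  | cons i w ih => intro m; simp [shuffle, ih]

theorem shuffle_smul_unit {d : ℕ} (a : ℝ) (w : Word d) :
    ∀ m : Tensor d, shuffle m (fun u => a * unit d u) w = a * m w := by
  induction w with
  | nil => intro m; simp [shuffle, unit, mul_comm]
  | cons i w ih =>
    intro m
    have h : (fun u : Word d => a * unit d (i :: u)) = fun _ => 0 := by
      funext u; simp [unit]
    rw [shuffle, h, shuffle_zero, ih, add_zero]

theorem shuffle_lin {d : ℕ} (c : Fin d → ℝ) (L : Tensor d) (h0 : L [] = 0)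
    (h1 : ∀ i u, L (i :: u) = c i * unit d u) (w : Word d) :
    ∀ (g : ℕ → ℝ), shuffle (fun u => g u.length * (u.map c).prod) L w
      = w.length * g (w.length - 1) * (w.map c).prod := by
  induction w with
  | nil => intro g; simp [shuffle, h0]
  | cons i w ih =>
    intro g
    have h : (fun u : Word d => g (i :: u).length * ((i :: u).map c).prod)
        = fun u => (fun n => c i * g (n + 1)) u.length * (u.map c).prod := by
      funext u; simp; ring
    have h' : (fun u => L (i :: u)) = fun u => c i * unit d u := by
      funext u; exact h1 i u
    rw [shuffle, h, h', ih (fun n => c i * g (n + 1)), shuffle_smul_unit]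
    cases w with
    | nil => simp [mul_comm]
    | cons j w => simp; ring

theorem shufflePow_lin {d : ℕ} (c : Fin d → ℝ) (L : Tensor d) (h0 : L [] = 0)
    (h1 : ∀ i u, L (i :: u) = c i * unit d u) (n : ℕ) :
    shufflePow L n = fun w =>
      (fun k => if k = n then (n.factorial : ℝ) else 0) w.length * (w.map c).prod := by
  induction n with
  | zero =>
    funext w
    cases w <;> simp [shufflePow, unit]
  | succ n ih =>
    funext w
    rw [shufflePow, ih, shuffle_lin c L h0 h1 w (fun k => if k = n then (n.factorial : ℝ) else 0)]
    cases w with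
    | nil => simp
    | cons i w =>
      by_cases h : w.length = n
      · simp [h, Nat.factorial_succ]
      · simp [h]

theorem shuffleExp_lin {d : ℕ} (c : Fin d → ℝ) (L : Tensor d) (h0 : L [] = 0)
    (h1 : ∀ i u, L (i :: u) = c i * unit d u) (w : Word d) :
    shuffleExp L w = (w.map c).prod := by
  rw [shuffleExp, tsum_eq_single w.length]
  · rw [shufflePow_lin c L h0 h1]
    have := Nat.factorial_ne_zero w.length
    simp
    field_simp
  · intro n hn
    rw [shufflePow_lin c L h0 h1]
    simp [hn.symm]

theorem sigma_nil (y kappa theta eta alpha : ℝ) :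
    sigmaMGBM y kappa theta eta alpha [] = y := by
  rw [sigmaMGBM, concatProd]
  simp only [List.length_nil, zero_add, Finset.range_one, Finset.sum_singleton, List.take_nil,
    List.drop_nil]
  rw [shuffleExp_lin ![-(kappa + alpha ^ 2 / 2), alpha] _ (by simp [letter])
    (by intro i u; fin_cases i <;> simp [letter, unit])]
  simp [unit, letter]

theorem sigma_cons (y kappa theta eta alpha : ℝ) (i : Fin 2) (w : Word 2) :
    sigmaMGBM y kappa theta eta alpha (i :: w) =
      (y * ![-(kappa + alpha ^ 2 / 2), alpha] i + ![kappa * theta - alpha * eta / 2, eta] i)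
        * (w.map ![-(kappa + alpha ^ 2 / 2), alpha]).prod := by
  rw [sigmaMGBM, concatProd]
  simp only [shuffleExp_lin ![-(kappa + alpha ^ 2 / 2), alpha]
    ((-(kappa + alpha ^ 2 / 2)) • letter (0 : Fin 2) + alpha • letter (1 : Fin 2))
    (by simp [letter]) (by intro i u; fin_cases i <;> simp [letter, unit])]
  rw [List.length_cons, Finset.sum_range_succ', Finset.sum_range_succ', Finset.sum_eq_zero]
  · fin_cases i <;> simp [letter, unit] <;> ring
  · intro k hk
    have hk' := Finset.mem_range.1 hk
    cases w with
    | nil => simp at hk'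
    | cons j w => simp [letter, unit]

theorem sigma_snoc (y kappa theta eta alpha : ℝ) (j : Fin 2) (w : Word 2) :
    sigmaMGBM y kappa theta eta alpha (w ++ [j]) =
      ![kappa * theta - alpha * eta / 2, eta] j * unit 2 w +
      ![-(kappa + alpha ^ 2 / 2), alpha] j * sigmaMGBM y kappa theta eta alpha w := by
  cases w with
  | nil => rw [List.nil_append, sigma_cons, sigma_nil]; simp [unit]; ring
  | cons i w => rw [List.cons_append, sigma_cons, sigma_cons]; simp [unit]; ring

/-- empty-word coefficient and projections of `σ^mGBM`:
`(σ^mGBM)^∅ = y`, `σ^mGBM π_1 = (κθ − αη/2)·𝟙 − (κ + α²/2)·σ^mGBM`,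
`σ^mGBM π_2 = η·𝟙 + α·σ^mGBM`, `σ^mGBM π_22 = αη·𝟙 + α²·σ^mGBM`. -/
theorem sigmaMGBM_projections (y kappa theta eta alpha : ℝ) :
    sigmaMGBM y kappa theta eta alpha ([] : Word 2) = y ∧
    proj (sigmaMGBM y kappa theta eta alpha) [(0 : Fin 2)] =
      (kappa * theta - alpha * eta / 2) • unit 2 -
        (kappa + alpha ^ 2 / 2) • sigmaMGBM y kappa theta eta alpha ∧
    proj (sigmaMGBM y kappa theta eta alpha) [(1 : Fin 2)] =
      eta • unit 2 + alpha • sigmaMGBM y kappa theta eta alpha ∧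
    proj (sigmaMGBM y kappa theta eta alpha) [(1 : Fin 2), (1 : Fin 2)] =
      (alpha * eta) • unit 2 + alpha ^ 2 • sigmaMGBM y kappa theta eta alpha := by
  refine ⟨sigma_nil .., ?_, ?_, ?_⟩
  · funext w
    rw [proj, sigma_snoc]
    simp
    ring
  · funext w
    rw [proj, sigma_snoc]
    simp
  · funext w
    have h : w ++ [(1 : Fin 2), 1] = (w ++ [1]) ++ [1] := by simp
    rw [proj, h, sigma_snoc, sigma_snoc]
    have h2 : unit 2 (w ++ [1]) = 0 := by simp [unit]
    rw [h2]
    simp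
    ring

end Sig
end
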